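/- Let n > 2 and q > 0 be integers and let p be a prime with p > (q-1)n + 1. Then the exact identity ∑_{k=0}^{p-1} ((1-p)_k (q)_k^n / (1)_k^{n+1}) · (∑_{i=0}^{k-1} 1/(q+i)^2 - H_k^{(2)}) = 0 holds in the rational numbers. -/

import Mathlib

/-- `H m k` is the `k`-th harmonic number of order `m`: `H_k^{(m)} = ∑_{j=1}^k 1/j^m`. -/
def harm (m k : ℕ) : ℚ := ∑ j ∈ Finset.range k, 1 / ((j : ℚ) + 1) ^ m

open Polynomial Finset in
/-- The alternating binomial sum of the values of a polynomial of degree `< N` vanishes. -/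
theorem sum_neg_one_pow_mul_choose_mul_eval_eq_zero {R : Type*} [CommRing R] (F : R[X]) {N : ℕ}
    (hF : F.natDegree < N) :
    ∑ k ∈ range (N + 1), (-1 : R) ^ k * (N.choose k : R) * F.eval (k : R) = 0 := by
  have h := congrFun (Polynomial.fwdDiff_iter_eq_zero_of_degree_lt hF) 0
  rw [fwdDiff_iter_eq_sum_shift] at h
  have h' := congrArg (fun x => (-1 : R) ^ N * x) h
  simp only [Pi.zero_apply, mul_zero, mul_sum] at h'
  rw [← h']
  refine sum_congr rfl fun k hk => ?_
  obtain ⟨d, rfl⟩ := Nat.exists_eq_add_of_le (Nat.lt_succ_iff.mp (mem_range.mp hk))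
  have hd : (-1 : R) ^ d * (-1) ^ d = 1 := by rw [← mul_pow]; simp
  simp only [zsmul_eq_mul, nsmul_eq_mul, mul_one, zero_add, Nat.add_sub_cancel_left]
  push_cast
  rw [pow_add]
  linear_combination (-(-1 : R) ^ k * ((k + d).choose k : R) * F.eval (k : R)) * hd

open Finset in
/-- Exchanging the shift and the length in a difference of two partial sums. -/
theorem sum_range_shift_sub_comm {G : Type*} [AddCommGroup G] (f : ℕ → G) (m k : ℕ) :
    ∑ i ∈ range k, f (m + i) - ∑ i ∈ range k, f i =
      ∑ j ∈ range m, f (k + j) - ∑ j ∈ range m, f j := by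
  have h₁ := sum_range_add f m k
  have h₂ := sum_range_add f k m
  rw [add_comm k m, h₁] at h₂
  rw [sub_eq_sub_iff_add_eq_add, add_comm, h₂, add_comm]

open Finset in
/-- `(m+1)_k / k!` is a polynomial in `k`. -/
theorem ascPochhammer_eval_succ_div_factorial (m k : ℕ) :
    (ascPochhammer ℚ k).eval ((m : ℚ) + 1) / (k.factorial : ℚ) =
      (∏ j ∈ range m, ((k : ℚ) + ((j : ℚ) + 1))) / (m.factorial : ℚ) := by
  have h : m.factorial * (m + 1).ascFactorial k = k.factorial * (k + 1).ascFactorial m := by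
    rw [Nat.factorial_mul_ascFactorial, Nat.factorial_mul_ascFactorial, add_comm]
  have h₁ : (ascPochhammer ℚ k).eval ((m : ℚ) + 1) = ((m + 1).ascFactorial k : ℚ) := by
    rw [← ascPochhammer_nat_eq_natCast_ascFactorial]; push_cast; rfl
  have h₂ : (∏ j ∈ range m, ((k : ℚ) + ((j : ℚ) + 1))) = ((k + 1).ascFactorial m : ℚ) := by
    rw [Nat.ascFactorial_eq_prod_range]
    push_cast
    exact prod_congr rfl fun j _ => by ring
  rw [h₁, h₂, div_eq_div_iff (by positivity) (by positivity)]
  have h' : ((m.factorial * (m + 1).ascFactorial k : ℕ) : ℚ) =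
      ((k.factorial * (k + 1).ascFactorial m : ℕ) : ℚ) := by rw [h]
  push_cast at h'
  linear_combination h'

theorem ascPochhammer_eval_neg_natCast_div_factorial (N k : ℕ) :
    (ascPochhammer ℚ k).eval (-(N : ℚ)) / (k.factorial : ℚ) = (-1) ^ k * (N.choose k : ℚ) := by
  rw [ascPochhammer_eval_neg_eq_descPochhammer, Nat.cast_choose_eq_descPochhammer_div, mul_div_assoc]

open Polynomial Finset in
/-- A polynomial of degree at most `n * m` interpolating
`∏ (k + j + 1) ^ n * (∑ 1 / (k + j + 1) ^ 2 - c)`. -/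
theorem exists_polynomial_eval_eq_prod_pow_mul_sum (n m : ℕ) (hn : 2 ≤ n) (c : ℚ) :
    ∃ F : ℚ[X], F.natDegree ≤ m * n ∧ ∀ k : ℕ, F.eval (k : ℚ) =
      (∏ j ∈ range m, ((k : ℚ) + ((j : ℚ) + 1))) ^ n *
        (∑ j ∈ range m, 1 / ((k : ℚ) + ((j : ℚ) + 1)) ^ 2 - c) := by
  obtain ⟨l, rfl⟩ := Nat.exists_eq_add_of_le' hn
  have hdeg (s : Finset ℕ) : (∏ j ∈ s, (X + C ((j : ℚ) + 1))).natDegree ≤ s.card := by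
    refine (natDegree_prod_le _ _).trans ?_
    simp only [natDegree_X_add_C, sum_const, smul_eq_mul, mul_one, le_refl]
  have hP := hdeg (range m)
  rw [card_range] at hP
  refine ⟨(∏ j ∈ range m, (X + C ((j : ℚ) + 1))) ^ l *
    (∑ j ∈ range m, (∏ i ∈ (range m).erase j, (X + C ((i : ℚ) + 1))) ^ 2 -
      C c * (∏ j ∈ range m, (X + C ((j : ℚ) + 1))) ^ 2), ?_, fun k => ?_⟩
  · rw [mul_add, mul_comm m l, mul_comm m 2]
    refine natDegree_mul_le_of_le (natDegree_pow_le_of_le _ hP) ?_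
    refine natDegree_sub_le_of_le (natDegree_sum_le_of_forall_le _ _ fun j _ => ?_)
      ((natDegree_C_mul_le _ _).trans (natDegree_pow_le_of_le _ hP)) |>.trans (max_self _).le
    refine natDegree_pow_le_of_le _ ((hdeg _).trans ?_)
    exact (card_le_card (erase_subset _ _)).trans (card_range m).le
  · simp only [eval_mul, eval_sub, eval_pow, eval_finsetSum, eval_prod, eval_add, eval_X, eval_C]
    rw [pow_add, mul_assoc]
    congr 1
    rw [mul_sub, mul_sum, mul_comm c]
    congr 1
    refine sum_congr rfl fun j hj => ?_
    have hne : (k : ℚ) + ((j : ℚ) + 1) ≠ 0 := by positivity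
    rw [← mul_prod_erase _ _ hj]
    field_simp

/-- Let `n > 2`, `q > 0` be integers and `p` a prime with `p > (q-1)n + 1`.
Then `∑_{k=0}^{p-1} ((1-p)_k (q)_k^n / (1)_k^{n+1}) (∑_{i=0}^{k-1} 1/(q+i)^2 - H_k^{(2)}) = 0`
holds exactly in `ℚ`. -/
theorem stmt_15 (n q : ℕ) (hn : 2 < n) (hq : 0 < q)
    (p : ℕ) (hp : p.Prime) (hgt : p > (q - 1) * n + 1) :
    ∑ k ∈ Finset.range p,
        (((ascPochhammer ℚ k).eval (1 - (p : ℚ)) * ((ascPochhammer ℚ k).eval (q : ℚ)) ^ n) /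
            ((ascPochhammer ℚ k).eval 1) ^ (n + 1)) *
          ((∑ i ∈ Finset.range k, 1 / ((q : ℚ) + (i : ℚ)) ^ 2) - harm 2 k)
      = 0 := by
  obtain ⟨m, rfl⟩ := Nat.exists_eq_add_of_le' hq
  obtain ⟨N, rfl⟩ := Nat.exists_eq_add_of_le' hp.one_le
  rw [Nat.add_sub_cancel] at hgt
  obtain ⟨F, hFdeg, hF⟩ := exists_polynomial_eval_eq_prod_pow_mul_sum n m hn.le
    (∑ j ∈ Finset.range m, 1 / ((j : ℚ) + 1) ^ 2)
  have hsum := sum_neg_one_pow_mul_choose_mul_eval_eq_zero F (N := N) (by omega)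
  rw [← zero_div ((m.factorial : ℚ) ^ n), ← hsum, Finset.sum_div]
  refine Finset.sum_congr rfl fun k _ => ?_
  have hshift : (∑ i ∈ Finset.range k, 1 / (((m + 1 : ℕ) : ℚ) + (i : ℚ)) ^ 2) - harm 2 k =
      ∑ j ∈ Finset.range m, 1 / ((k : ℚ) + ((j : ℚ) + 1)) ^ 2 -
        ∑ j ∈ Finset.range m, 1 / ((j : ℚ) + 1) ^ 2 := by
    have h := sum_range_shift_sub_comm (fun i : ℕ => 1 / ((i : ℚ) + 1) ^ 2) m k
    simp only [Nat.cast_add, add_assoc] at h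
    rw [harm, ← h]
    simp only [Nat.cast_add, Nat.cast_one, add_assoc, add_comm (1 : ℚ)]
  have hneg : (1 : ℚ) - ((N + 1 : ℕ) : ℚ) = -(N : ℚ) := by push_cast; ring
  rw [hshift, hF, hneg, ascPochhammer_eval_one, pow_succ', mul_div_mul_comm, ← div_pow,
    Nat.cast_succ, ascPochhammer_eval_succ_div_factorial,
    ascPochhammer_eval_neg_natCast_div_factorial, div_pow]
  ring
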